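/- arXiv:1812.10551 — 5 statements merged into one kernel-verified Lean document; each statement's English description precedes it below -/
import Mathlib

section
/- Let m ≥ 1 and let p₀ and p be probability density functions on the open positive orthant (0,∞)^m ⊆ ℝ^m, each continuously differentiable and strictly positive on (0,∞)^m and integrating to 1 over (0,∞)^m. Let h₁,…,h_m : (0,∞) → [0,∞) be measurable with h_j(x) > 0 for Lebesgue-almost every x > 0. If ∫_{(0,∞)^m} p₀(x) Σ_{j=1}^m h_j(x_j) (∂_j log p(x) − ∂_j log p₀(x))² dx = 0, then p(x) = p₀(x) for every x ∈ (0,∞)^m; consequently p₀ is the unique minimizer of the generalized h-score matching loss J_h over such densities. -/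
open MeasureTheory Filter Topology

/-- The `j`-th partial derivative of `log f` at `x`, taken along the `j`-th coordinate. -/
noncomputable def pdLog {m : ℕ} (f : (Fin m → ℝ) → ℝ) (j : Fin m) (x : Fin m → ℝ) : ℝ :=
  deriv (fun t => Real.log (f (Function.update x j t))) (x j)

theorem isOpen_positiveOrthant (m : ℕ) : IsOpen {x : Fin m → ℝ | ∀ j, 0 < x j} := by
  simp only [Set.ofPred_forall]
  exact isOpen_iInter_of_finite fun j => isOpen_lt continuous_const (continuous_apply j)

theorem convex_positiveOrthant (m : ℕ) : Convex ℝ {x : Fin m → ℝ | ∀ j, 0 < x j} := by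
  intro x hx y hy a b ha hb hab j
  exact (convex_Ioi (0 : ℝ)) (hx j) (hy j) ha hb hab

theorem pdLog_eq_fderiv {m : ℕ} {f : (Fin m → ℝ) → ℝ} {x : Fin m → ℝ} (j : Fin m)
    (hf : DifferentiableAt ℝ (fun y => Real.log (f y)) x) :
    pdLog f j x = fderiv ℝ (fun y => Real.log (f y)) x (Pi.single j 1) := by
  have hu : HasDerivAt (Function.update x j) (Pi.single j (1 : ℝ)) (x j) :=
    hasDerivAt_update x j (x j)
  have hf' : HasFDerivAt (fun y => Real.log (f y)) (fderiv ℝ (fun y => Real.log (f y)) x)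
      (Function.update x j (x j)) := by
    simpa using hf.hasFDerivAt
  exact (hf'.comp_hasDerivAt (x j) hu).deriv

/-- A property holding almost everywhere on the positive half-line holds for the `j`-th
coordinate of almost every point of the positive orthant. -/
theorem ae_positiveOrthant_eval {m : ℕ} (j : Fin m) {P : ℝ → Prop}
    (hP : ∀ᵐ t ∂(volume.restrict (Set.Ioi (0 : ℝ))), P t) :
    ∀ᵐ x ∂(volume.restrict {x : Fin m → ℝ | ∀ j, 0 < x j}), P (x j) := by
  rw [ae_restrict_iff' measurableSet_Ioi] at hP
  rw [ae_restrict_iff' (isOpen_positiveOrthant m).measurableSet]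
  have := (Measure.quasiMeasurePreserving_eval (fun _ : Fin m => (volume : Measure ℝ)) j).ae hP
  filter_upwards [this] with x hx hxS
  exact hx (hxS j)

/-- If the generalized `h`-score matching loss between `p` and `p₀` vanishes, then `p = p₀`
on the open positive orthant. -/
theorem stmt_0 (m : ℕ) (hm : 1 ≤ m)
    (p₀ p : (Fin m → ℝ) → ℝ)
    (S : Set (Fin m → ℝ)) (hS : S = {x | ∀ j, 0 < x j})
    (hp₀C1 : ContDiffOn ℝ 1 p₀ S) (hpC1 : ContDiffOn ℝ 1 p S)
    (hp₀pos : ∀ x ∈ S, 0 < p₀ x) (hppos : ∀ x ∈ S, 0 < p x)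
    (hp₀int : (∫ x in S, p₀ x) = 1) (hpint : (∫ x in S, p x) = 1)
    (h : Fin m → ℝ → ℝ)
    (hmeas : ∀ j, Measurable (h j))
    (hnn : ∀ j, ∀ t : ℝ, 0 < t → 0 ≤ h j t)
    (hpos : ∀ j, ∀ᵐ t ∂(volume.restrict (Set.Ioi (0 : ℝ))), 0 < h j t)
    (hloss : (∫⁻ x in S, ENNReal.ofReal
        (p₀ x * ∑ j, h j (x j) * (pdLog p j x - pdLog p₀ j x) ^ 2)) = 0) :
    ∀ x ∈ S, p x = p₀ x := by
  have hSo : IsOpen S := hS ▸ isOpen_positiveOrthant m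
  have hSc : Convex ℝ S := hS ▸ convex_positiveOrthant m
  have hSm : MeasurableSet S := hSo.measurableSet
  have hlog : ∀ f : (Fin m → ℝ) → ℝ, ContDiffOn ℝ 1 f S → (∀ x ∈ S, 0 < f x) →
      ContDiffOn ℝ 1 (fun y => Real.log (f y)) S :=
    fun f hf hf0 => hf.log fun x hx => (hf0 x hx).ne'
  have hdiff : ∀ f : (Fin m → ℝ) → ℝ, ContDiffOn ℝ 1 f S → (∀ x ∈ S, 0 < f x) →
      ∀ x ∈ S, DifferentiableAt ℝ (fun y => Real.log (f y)) x := fun f hf hf0 x hx =>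
    ((hlog f hf hf0).differentiableOn one_ne_zero).differentiableAt (hSo.mem_nhds hx)
  have hcont : ∀ f : (Fin m → ℝ) → ℝ, ContDiffOn ℝ 1 f S → (∀ x ∈ S, 0 < f x) →
      ∀ j, ContinuousOn (pdLog f j) S := fun f hf hf0 j =>
    (((hlog f hf hf0).continuousOn_fderiv_of_isOpen hSo le_rfl).clm_apply
      continuousOn_const).congr fun x hx => pdLog_eq_fderiv j (hdiff f hf hf0 x hx)
  have hmeasInt : AEMeasurable (fun x => ENNReal.ofReal
      (p₀ x * ∑ j, h j (x j) * (pdLog p j x - pdLog p₀ j x) ^ 2)) (volume.restrict S) := by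
    refine ((hp₀C1.continuousOn.aemeasurable hSm).mul
      (Finset.aemeasurable_fun_sum _ fun j _ => ?_)).ennreal_ofReal
    exact ((hmeas j).comp (measurable_pi_apply j)).aemeasurable.mul
      ((((hcont p hpC1 hppos j).sub (hcont p₀ hp₀C1 hp₀pos j)).aemeasurable hSm).pow_const 2)
  have hae := (lintegral_eq_zero_iff' hmeasInt).1 hloss
  have hscore : ∀ j, Set.EqOn (pdLog p j) (pdLog p₀ j) S := by
    intro j
    refine Measure.eqOn_open_of_ae_eq (μ := volume) ?_ hSo
      (hcont p hpC1 hppos j) (hcont p₀ hp₀C1 hp₀pos j)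
    have hj : ∀ᵐ x ∂(volume.restrict S), 0 < h j (x j) :=
      hS ▸ ae_positiveOrthant_eval j (hpos j)
    filter_upwards [hae, hj, ae_restrict_mem hSm] with x hx hxj hxS
    have hterm : ∀ i ∈ Finset.univ, 0 ≤ h i (x i) * (pdLog p i x - pdLog p₀ i x) ^ 2 :=
      fun i _ => mul_nonneg (hnn i _ ((hS ▸ hxS : x ∈ {x | ∀ j, 0 < x j}) i)) (sq_nonneg _)
    have hsum : ∑ i, h i (x i) * (pdLog p i x - pdLog p₀ i x) ^ 2 = 0 := by
      refine le_antisymm ?_ (Finset.sum_nonneg hterm)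
      have := ENNReal.ofReal_eq_zero.1 hx
      exact nonpos_of_mul_nonpos_right this (hp₀pos x hxS)
    have := (Finset.sum_eq_zero_iff_of_nonneg hterm).1 hsum j (Finset.mem_univ j)
    have := (mul_eq_zero.1 this).resolve_left hxj.ne'
    exact sub_eq_zero.1 (pow_eq_zero_iff two_ne_zero |>.1 this)
  have hfderiv : Set.EqOn (fderiv ℝ fun y => Real.log (p y))
      (fderiv ℝ fun y => Real.log (p₀ y)) S := by
    intro x hx
    refine ContinuousLinearMap.coe_injective (LinearMap.pi_ext' fun j => LinearMap.ext_ring ?_)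
    simpa [pdLog_eq_fderiv j (hdiff p hpC1 hppos x hx),
      pdLog_eq_fderiv j (hdiff p₀ hp₀C1 hp₀pos x hx)] using hscore j hx
  intro x hx
  have hratio : ∀ y ∈ S, p y = p x / p₀ x * p₀ y := by
    intro y hy
    have hconst := hSo.is_const_of_fderiv_eq_zero (𝕜 := ℝ) hSc.isPreconnected
      (f := fun y => Real.log (p y) - Real.log (p₀ y))
      (fun z hz => ((hdiff p hpC1 hppos z hz).sub
        (hdiff p₀ hp₀C1 hp₀pos z hz)).differentiableWithinAt)
      (fun z hz => by
        rw [fderiv_fun_sub (hdiff p hpC1 hppos z hz) (hdiff p₀ hp₀C1 hp₀pos z hz),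
          hfderiv hz, sub_self, Pi.zero_apply]) hy hx
    rw [← Real.log_div (hppos y hy).ne' (hp₀pos y hy).ne',
      ← Real.log_div (hppos x hx).ne' (hp₀pos x hx).ne'] at hconst
    have := Real.log_injOn_pos (div_pos (hppos y hy) (hp₀pos y hy))
      (div_pos (hppos x hx) (hp₀pos x hx)) hconst
    rw [← this, div_mul_cancel₀ _ (hp₀pos y hy).ne']
  have hone : p x / p₀ x = 1 := by
    rw [setIntegral_congr_fun hSm hratio, integral_const_mul, hp₀int, mul_one] at hpint
    exact hpint
  rw [hratio x hx, hone, one_mul]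
end

section
/- Let p₀ and p be twice continuously differentiable, strictly positive probability densities on (0,∞)^m, and let h₁,…,h_m : (0,∞) → [0,∞) be continuously differentiable. Assume: (A1) for every j and every fixed x_{−j} ∈ (0,∞)^{m−1}, the function x_j ↦ p₀(x) h_j(x_j) ∂_j log p(x) has finite limits as x_j → 0⁺ and as x_j → +∞ and these two limits are equal; (A2) ∫ p₀(x) Σ_j h_j(x_j)(∂_j log p(x))² dx < ∞, ∫ p₀(x) Σ_j h_j(x_j)(∂_j log p₀(x))² dx < ∞, and ∫ p₀(x) Σ_j |h_j'(x_j) ∂_j log p(x) + h_j(x_j) ∂_{jj} log p(x)| dx < ∞. Then J_h(p) = ∫_{(0,∞)^m} p₀(x) Σ_{j=1}^m [ h_j'(x_j) ∂_j log p(x) + h_j(x_j) ∂_{jj} log p(x) + (1/2) h_j(x_j)(∂_j log p(x))² ] dx + (1/2)∫_{(0,∞)^m} p₀(x) Σ_{j=1}^m h_j(x_j)(∂_j log p₀(x))² dx, where the last term does not depend on p. -/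
open MeasureTheory Filter Topology

/-- The `j`-th second partial derivative of `log f` at `x`. -/
noncomputable def pd2Log {m : ℕ} (f : (Fin m → ℝ) → ℝ) (j : Fin m) (x : Fin m → ℝ) : ℝ :=
  deriv (deriv (fun t => Real.log (f (Function.update x j t)))) (x j)

/-- Fundamental theorem of calculus on `(a, ∞)`, for a function with equal one-sided limits at the
two ends. No integrability is assumed: otherwise the integral vanishes by convention. -/
lemma integral_Ioi_deriv_eq_zero_of_tendsto {f f' : ℝ → ℝ} {a L : ℝ}
    (hderiv : ∀ t ∈ Set.Ioi a, HasDerivAt f (f' t) t)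
    (ha : Tendsto f (𝓝[>] a) (𝓝 L)) (htop : Tendsto f atTop (𝓝 L)) :
    ∫ t in Set.Ioi a, f' t = 0 := by
  by_cases hint : IntegrableOn f' (Set.Ioi a)
  · have hne : ∀ t ∈ Set.Ioi a, Function.update f a L =ᶠ[𝓝 t] f := fun t ht => by
      filter_upwards [isOpen_Ioi.mem_nhds ht] with s hs
      exact Function.update_of_ne (ne_of_gt hs) _ _
    have := integral_Ioi_of_hasDerivAt_of_tendsto (f := Function.update f a L) (f' := f')
      (a := a) (m := L) (by simpa using ha)
      (fun t ht => (hderiv t ht).congr_of_eventuallyEq (hne t ht)) hint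
      (htop.congr' (by
        filter_upwards [eventually_gt_atTop a] with s hs
        exact (Function.update_of_ne (ne_of_gt hs) _ _).symm))
    simpa using this
  · exact integral_undef hint

/-- If `G` has equal limits at both ends of each half-line in direction `j`, its `j`-th partial
derivative integrates to zero over the positive orthant. -/
lemma setIntegral_partialDeriv_eq_zero {m : ℕ} (j : Fin m) {G G' : (Fin m → ℝ) → ℝ}
    (hderiv : ∀ x ∈ {x : Fin m → ℝ | ∀ i, 0 < x i},
      HasDerivAt (fun t => G (Function.update x j t)) (G' x) (x j))
    (hint : IntegrableOn G' {x : Fin m → ℝ | ∀ i, 0 < x i})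
    (hlim : ∀ x ∈ {x : Fin m → ℝ | ∀ i, 0 < x i}, ∃ L : ℝ,
      Tendsto (fun t => G (Function.update x j t)) (𝓝[>] 0) (𝓝 L) ∧
      Tendsto (fun t => G (Function.update x j t)) atTop (𝓝 L)) :
    ∫ x in {x : Fin m → ℝ | ∀ i, 0 < x i}, G' x = 0 := by
  obtain _ | n := m
  · exact j.elim0
  have hS : MeasurableSet {x : Fin (n + 1) → ℝ | ∀ i, 0 < x i} := by measurability
  set S := {x : Fin (n + 1) → ℝ | ∀ i, 0 < x i} with hSdef
  have hmem : ∀ (t : ℝ) (y : Fin n → ℝ), j.insertNth (α := fun _ => ℝ) t y ∈ S ↔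
      0 < t ∧ ∀ i, 0 < y i := fun t y => by
    simp [hSdef, Fin.forall_iff_succAbove j]
  have hmp := (volume_preserving_piFinSuccAbove (fun _ : Fin (n + 1) => ℝ) j).symm
  rw [← integral_indicator hS, ← hmp.integral_comp', Measure.volume_eq_prod,
    integral_prod_symm (fun z => S.indicator G' ((MeasurableEquiv.piFinSuccAbove _ j).symm z)) ((hmp.integrable_comp_emb (MeasurableEquiv.measurableEmbedding _)).2
      ((integrable_indicator_iff hS).2 hint))]
  refine integral_eq_zero_of_ae (Eventually.of_forall fun y => ?_)
  change ∫ t, S.indicator G' (j.insertNth (α := fun _ => ℝ) t y) = 0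
  by_cases hy : ∀ i, 0 < y i
  · have hind : (fun t : ℝ => S.indicator G' (j.insertNth (α := fun _ => ℝ) t y)) =
        (Set.Ioi (0 : ℝ)).indicator (fun t => G' (j.insertNth (α := fun _ => ℝ) t y)) := by
      funext t
      simp only [Set.indicator_apply, hmem, hy, implies_true, and_true, Set.mem_Ioi]
    rw [hind, integral_indicator measurableSet_Ioi]
    obtain ⟨L, h0, htop⟩ := hlim (j.insertNth (α := fun _ => ℝ) 1 y) ((hmem _ _).2 ⟨one_pos, hy⟩)
    simp only [Fin.update_insertNth] at h0 htop
    refine integral_Ioi_deriv_eq_zero_of_tendsto (fun t ht => ?_) h0 htop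
    simpa using hderiv (j.insertNth (α := fun _ => ℝ) t y) ((hmem _ _).2 ⟨ht, hy⟩)
  · simp [hmem, hy]

lemma ContDiffOn.hasDerivAt_update_of_isOpen {m : ℕ} {S : Set (Fin m → ℝ)} (hS : IsOpen S)
    {F : (Fin m → ℝ) → ℝ} (hF : ContDiffOn ℝ 1 F S) (j : Fin m) {x : Fin m → ℝ} (hx : x ∈ S) :
    HasDerivAt (fun t => F (Function.update x j t)) (fderiv ℝ F x (Pi.single j 1)) (x j) := by
  have hd : HasFDerivAt F (fderiv ℝ F x) (Function.update x j (x j)) := by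
    rw [Function.update_eq_self]
    exact ((hF.differentiableOn one_ne_zero).differentiableAt (hS.mem_nhds hx)).hasFDerivAt
  exact hd.comp_hasDerivAt (x j) (hasDerivAt_update x j (x j))

lemma ContDiffOn.fderiv_apply_of_isOpen {m : ℕ} {S : Set (Fin m → ℝ)} (hS : IsOpen S)
    {F : (Fin m → ℝ) → ℝ} {k n : ℕ} (hF : ContDiffOn ℝ n F S) (hk : k + 1 ≤ n)
    (v : Fin m → ℝ) : ContDiffOn ℝ k (fun x => fderiv ℝ F x v) S :=
  (hF.fderiv_of_isOpen hS (by exact_mod_cast hk)).clm_apply contDiffOn_const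

section

variable {m : ℕ} {S : Set (Fin m → ℝ)} {f : (Fin m → ℝ) → ℝ}

lemma contDiffOn_pdLog (hS : IsOpen S) (hf : ContDiffOn ℝ 2 f S) (hpos : ∀ x ∈ S, 0 < f x)
    (j : Fin m) : ContDiffOn ℝ 1 (pdLog f j) S := by
  have hlog : ContDiffOn ℝ 2 (fun x => Real.log (f x)) S := hf.log fun x hx => (hpos x hx).ne'
  refine (hlog.fderiv_apply_of_isOpen (k := 1) (n := 2) hS le_rfl (Pi.single j 1)).congr
    fun x hx => ?_
  exact ((hlog.of_le one_le_two).hasDerivAt_update_of_isOpen hS j hx).deriv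

lemma pdLog_update (f : (Fin m → ℝ) → ℝ) (j : Fin m) (x : Fin m → ℝ) (t : ℝ) :
    pdLog f j (Function.update x j t) = deriv (fun s => Real.log (f (Function.update x j s))) t := by
  simp [pdLog]

lemma hasDerivAt_pdLog (hS : IsOpen S) (hf : ContDiffOn ℝ 2 f S) (hpos : ∀ x ∈ S, 0 < f x)
    (j : Fin m) {x : Fin m → ℝ} (hx : x ∈ S) :
    HasDerivAt (fun t => pdLog f j (Function.update x j t)) (pd2Log f j x) (x j) := by
  have h := (contDiffOn_pdLog hS hf hpos j).hasDerivAt_update_of_isOpen hS j hx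
  have he : pd2Log f j x = deriv (fun t => pdLog f j (Function.update x j t)) (x j) := by
    simp only [pdLog_update, pd2Log]
  rw [he, h.deriv]
  exact h

lemma continuousOn_pd2Log (hS : IsOpen S) (hf : ContDiffOn ℝ 2 f S) (hpos : ∀ x ∈ S, 0 < f x)
    (j : Fin m) : ContinuousOn (pd2Log f j) S := by
  have hc := contDiffOn_pdLog hS hf hpos j
  refine (ContDiffOn.fderiv_apply_of_isOpen (k := 0) (n := 1) hS hc le_rfl
    (Pi.single j 1)).continuousOn.congr fun x hx => ?_
  exact (hasDerivAt_pdLog hS hf hpos j hx).unique (hc.hasDerivAt_update_of_isOpen hS j hx)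

lemma hasDerivAt_update_eq_mul_pdLog (hS : IsOpen S) (hf : ContDiffOn ℝ 2 f S)
    (hpos : ∀ x ∈ S, 0 < f x) (j : Fin m) {x : Fin m → ℝ} (hx : x ∈ S) :
    HasDerivAt (fun t => f (Function.update x j t)) (f x * pdLog f j x) (x j) := by
  have h := (hf.of_le one_le_two).hasDerivAt_update_of_isOpen hS j hx
  have hne : f (Function.update x j (x j)) ≠ 0 := by
    rw [Function.update_eq_self]
    exact (hpos x hx).ne'
  convert h using 1
  rw [pdLog, (h.log hne).deriv, Function.update_eq_self]
  exact mul_div_cancel₀ _ (hpos x hx).ne'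

end

/-- A continuous term dominated by one summand of an integrable weighted sum of nonnegative
functions is integrable. -/
lemma IntegrableOn.of_abs_le_mul_sum {m : ℕ} {S : Set (Fin m → ℝ)} (hS : MeasurableSet S)
    {w u : (Fin m → ℝ) → ℝ} {g : Fin m → (Fin m → ℝ) → ℝ} (hw : ∀ x ∈ S, 0 ≤ w x)
    (hg : ∀ i, ∀ x ∈ S, 0 ≤ g i x) (hint : IntegrableOn (fun x => w x * ∑ i, g i x) S)
    (hu : ContinuousOn u S) (j : Fin m) (hle : ∀ x ∈ S, |u x| ≤ w x * g j x) :
    IntegrableOn u S := by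
  refine hint.mono' (hu.aestronglyMeasurable hS) ?_
  filter_upwards [ae_restrict_mem hS] with x hx
  exact (hle x hx).trans (mul_le_mul_of_nonneg_left
    (Finset.single_le_sum (fun i _ => hg i x hx) (Finset.mem_univ j)) (hw x hx))

/-- Integration-by-parts identity for the generalized `h`-score matching loss. -/
theorem stmt_1 (m : ℕ)
    (p₀ p : (Fin m → ℝ) → ℝ)
    (S : Set (Fin m → ℝ)) (hS : S = {x | ∀ j, 0 < x j})
    (hp₀C2 : ContDiffOn ℝ 2 p₀ S) (hpC2 : ContDiffOn ℝ 2 p S)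
    (hp₀pos : ∀ x ∈ S, 0 < p₀ x) (hppos : ∀ x ∈ S, 0 < p x)
    (hp₀int : (∫ x in S, p₀ x) = 1) (hpint : (∫ x in S, p x) = 1)
    (h : Fin m → ℝ → ℝ)
    (hhC1 : ∀ j, ContDiffOn ℝ 1 (h j) (Set.Ioi (0 : ℝ)))
    (hnn : ∀ j, ∀ t : ℝ, 0 < t → 0 ≤ h j t)
    -- (A1): finite equal limits at the boundary
    (hA1 : ∀ j, ∀ x ∈ S, ∃ L : ℝ,
      Tendsto (fun t : ℝ => p₀ (Function.update x j t) * h j t *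
          pdLog p j (Function.update x j t)) (𝓝[>] (0 : ℝ)) (𝓝 L) ∧
      Tendsto (fun t : ℝ => p₀ (Function.update x j t) * h j t *
          pdLog p j (Function.update x j t)) atTop (𝓝 L))
    -- (A2): integrability conditions
    (hA2a : IntegrableOn (fun x => p₀ x * ∑ j, h j (x j) * (pdLog p j x) ^ 2) S)
    (hA2b : IntegrableOn (fun x => p₀ x * ∑ j, h j (x j) * (pdLog p₀ j x) ^ 2) S)
    (hA2c : IntegrableOn (fun x => p₀ x * ∑ j,
        |deriv (h j) (x j) * pdLog p j x + h j (x j) * pd2Log p j x|) S) :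
    (1/2) * (∫ x in S, p₀ x * ∑ j, h j (x j) * (pdLog p j x - pdLog p₀ j x) ^ 2)
      = (∫ x in S, p₀ x * ∑ j, (deriv (h j) (x j) * pdLog p j x
          + h j (x j) * pd2Log p j x + (1/2) * h j (x j) * (pdLog p j x) ^ 2))
        + (1/2) * (∫ x in S, p₀ x * ∑ j, h j (x j) * (pdLog p₀ j x) ^ 2) := by
  have hSo : IsOpen S := by
    rw [hS, Set.ofPred_forall]
    exact isOpen_iInter_of_finite fun j => isOpen_lt continuous_const (continuous_apply j)
  have hSm := hSo.measurableSet
  have hxpos : ∀ j, ∀ x ∈ S, 0 < x j := fun j x hx => by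
    rw [hS] at hx
    exact hx j
  have hmaps : ∀ j, Set.MapsTo (fun x : Fin m → ℝ => x j) S (Set.Ioi 0) := hxpos
  have hproj : ∀ j, ContinuousOn (fun x : Fin m → ℝ => x j) S := fun j =>
    (continuous_apply j).continuousOn
  have cp₀ : ContinuousOn p₀ S := hp₀C2.continuousOn
  have ch : ∀ j, ContinuousOn (fun x => h j (x j)) S := fun j =>
    (hhC1 j).continuousOn.comp (hproj j) (hmaps j)
  have ch' : ∀ j, ContinuousOn (fun x => deriv (h j) (x j)) S := fun j =>
    ((hhC1 j).continuousOn_deriv_of_isOpen isOpen_Ioi le_rfl).comp (hproj j) (hmaps j)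
  have ca : ∀ j, ContinuousOn (pdLog p j) S := fun j =>
    (contDiffOn_pdLog hSo hpC2 hppos j).continuousOn
  have cb : ∀ j, ContinuousOn (pdLog p₀ j) S := fun j =>
    (contDiffOn_pdLog hSo hp₀C2 hp₀pos j).continuousOn
  have ca2 : ∀ j, ContinuousOn (pd2Log p j) S := continuousOn_pd2Log hSo hpC2 hppos
  have hw : ∀ x ∈ S, 0 ≤ p₀ x := fun x hx => (hp₀pos x hx).le
  have hh : ∀ j, ∀ x ∈ S, 0 ≤ h j (x j) := fun j x hx => hnn j _ (hxpos j x hx)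
  have ia : ∀ j, IntegrableOn (fun x => p₀ x * (h j (x j) * (pdLog p j x) ^ 2)) S := fun j =>
    IntegrableOn.of_abs_le_mul_sum hSm hw (fun i x hx => mul_nonneg (hh i x hx) (sq_nonneg _)) hA2a
      (cp₀.mul ((ch j).mul ((ca j).pow 2))) j fun x hx =>
      (abs_of_nonneg (mul_nonneg (hw x hx) (mul_nonneg (hh j x hx) (sq_nonneg _)))).le
  have ib : ∀ j, IntegrableOn (fun x => p₀ x * (h j (x j) * (pdLog p₀ j x) ^ 2)) S := fun j =>
    IntegrableOn.of_abs_le_mul_sum hSm hw (fun i x hx => mul_nonneg (hh i x hx) (sq_nonneg _)) hA2b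
      (cp₀.mul ((ch j).mul ((cb j).pow 2))) j fun x hx =>
      (abs_of_nonneg (mul_nonneg (hw x hx) (mul_nonneg (hh j x hx) (sq_nonneg _)))).le
  have ic : ∀ j, IntegrableOn (fun x => p₀ x *
      (deriv (h j) (x j) * pdLog p j x + h j (x j) * pd2Log p j x)) S := fun j =>
    IntegrableOn.of_abs_le_mul_sum hSm hw (fun i x _ => abs_nonneg _) hA2c
      (cp₀.mul (((ch' j).mul (ca j)).add ((ch j).mul (ca2 j)))) j fun x hx => by
        rw [abs_mul, abs_of_nonneg (hw x hx)]
  have iab : ∀ j, IntegrableOn (fun x => p₀ x * (h j (x j) * (pdLog p j x * pdLog p₀ j x))) S :=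
    fun j => by
    refine ((ia j).add (ib j)).mono'
      ((cp₀.mul ((ch j).mul ((ca j).mul (cb j)))).aestronglyMeasurable hSm) ?_
    filter_upwards [ae_restrict_mem hSm] with x hx
    have hab : |pdLog p j x * pdLog p₀ j x| ≤ (pdLog p j x) ^ 2 + (pdLog p₀ j x) ^ 2 :=
      abs_le.2 ⟨by nlinarith [sq_nonneg (pdLog p j x + pdLog p₀ j x)],
        by nlinarith [sq_nonneg (pdLog p j x - pdLog p₀ j x)]⟩
    rw [Real.norm_eq_abs, abs_mul, abs_mul, abs_of_nonneg (hw x hx), abs_of_nonneg (hh j x hx),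
      Pi.add_apply, ← mul_add, ← mul_add]
    exact mul_le_mul_of_nonneg_left (mul_le_mul_of_nonneg_left hab (hh j x hx)) (hw x hx)
  have iD : ∀ j, IntegrableOn (fun x =>
      p₀ x * (deriv (h j) (x j) * pdLog p j x + h j (x j) * pd2Log p j x) +
        p₀ x * (h j (x j) * (pdLog p j x * pdLog p₀ j x))) S := fun j => (ic j).add (iab j)
  have hparts : ∀ j, ∫ x in S, (p₀ x *
      (deriv (h j) (x j) * pdLog p j x + h j (x j) * pd2Log p j x) +
        p₀ x * (h j (x j) * (pdLog p j x * pdLog p₀ j x))) = 0 := fun j => by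
    have iDj := iD j
    have hlim := hA1 j
    have hderiv : ∀ x ∈ S, HasDerivAt (fun t => p₀ (Function.update x j t) *
        h j (Function.update x j t j) * pdLog p j (Function.update x j t))
        (p₀ x * (deriv (h j) (x j) * pdLog p j x + h j (x j) * pd2Log p j x) +
          p₀ x * (h j (x j) * (pdLog p j x * pdLog p₀ j x))) (x j) := fun x hx => by
      have hhd : HasDerivAt (h j) (deriv (h j) (x j)) (x j) :=
        (((hhC1 j).differentiableOn one_ne_zero).differentiableAt
          (isOpen_Ioi.mem_nhds (hxpos j x hx))).hasDerivAt
      have hd := ((hasDerivAt_update_eq_mul_pdLog hSo hp₀C2 hp₀pos j hx).mul hhd).mul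
        (hasDerivAt_pdLog hSo hpC2 hppos j hx)
      simp only [Function.update_self]
      refine hd.congr_deriv ?_
      simp only [Pi.mul_apply, Function.update_eq_self]
      ring
    subst hS
    exact setIntegral_partialDeriv_eq_zero j
      (G := fun x => p₀ x * h j (x j) * pdLog p j x) hderiv iDj
      (by simpa only [Function.update_self] using hlim)
  have i1 : IntegrableOn (fun x => p₀ x * ∑ j, (deriv (h j) (x j) * pdLog p j x
      + h j (x j) * pd2Log p j x + (1/2) * h j (x j) * (pdLog p j x) ^ 2)) S := by
    simp only [Finset.mul_sum]
    refine integrable_finsetSum _ fun j _ => ((ic j).add ((ia j).const_mul (1/2))).congr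
      (Eventually.of_forall fun x => ?_)
    simp only [Pi.add_apply]
    ring
  have hsum : ∫ x in S, ∑ j, (p₀ x *
      (deriv (h j) (x j) * pdLog p j x + h j (x j) * pd2Log p j x) +
        p₀ x * (h j (x j) * (pdLog p j x * pdLog p₀ j x))) = 0 := by
    rw [integral_finsetSum _ fun j _ => iD j]
    exact Finset.sum_eq_zero fun j _ => hparts j
  rw [← integral_const_mul, ← integral_const_mul,
    ← integral_add i1 (hA2b.const_mul (1/2)), ← sub_zero (∫ x in S, _ + _), ← hsum,
    ← integral_sub _ (integrable_finsetSum _ fun j _ => iD j)]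
  rotate_left
  · exact i1.add (hA2b.const_mul (1/2))
  congr 1
  funext x
  simp only [Finset.mul_sum, ← Finset.sum_add_distrib, ← Finset.sum_sub_distrib]
  exact Finset.sum_congr rfl fun j _ => by ring
end

section
/- Let m ≥ 1, let K ∈ ℝ^{m×m} be strictly co-positive, i.e. vᵀKv > 0 for every v ∈ [0,∞)^m with v ≠ 0, and let a, b ∈ ℝ satisfy 2a > b > 0. Then for every η ∈ ℝ^m, the function x ↦ exp( −(1/(2a)) (x^a)ᵀ K x^a + Σ_{j=1}^m η_j (x_j^b − 1)/b ) is Lebesgue integrable over (0,∞)^m, where x^a denotes the componentwise power (x₁^a, …, x_m^a). -/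
open MeasureTheory Matrix

/-- A quadratic form that is strictly positive on the nonnegative orthant minus the origin
dominates a positive multiple of the sum of squares there. -/
theorem exists_pos_mul_sum_sq_le_of_strictly_copositive {ι : Type*} [Fintype ι]
    (K : Matrix ι ι ℝ)
    (hK : ∀ v : ι → ℝ, (∀ j, 0 ≤ v j) → v ≠ 0 → 0 < v ⬝ᵥ K.mulVec v) :
    ∃ c > 0, ∀ v : ι → ℝ, (∀ j, 0 ≤ v j) → c * ∑ j, v j ^ 2 ≤ v ⬝ᵥ K.mulVec v := by
  have hcont : Continuous fun v : ι → ℝ => v ⬝ᵥ K.mulVec v := by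
    simp only [dotProduct, mulVec]
    fun_prop
  set S : Set (ι → ℝ) := {v | (∀ j, 0 ≤ v j) ∧ ∑ j, v j ^ 2 = 1}
  have hSc : IsCompact S := by
    refine (isCompact_univ_pi fun _ : ι => isCompact_Icc (a := (0 : ℝ)) (b := 1)).of_isClosed_subset
      ?_ ?_
    · have hsum : Continuous fun v : ι → ℝ => ∑ j, v j ^ 2 := by fun_prop
      exact (isClosed_Ici (a := (0 : ι → ℝ))).inter (isClosed_eq hsum continuous_const)
    · rintro v ⟨hv, hs⟩ j -
      have hj : v j ^ 2 ≤ 1 :=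
        hs ▸ Finset.single_le_sum (f := fun i => v i ^ 2) (fun i _ => sq_nonneg _)
          (Finset.mem_univ j)
      exact ⟨hv j, by nlinarith [hv j]⟩
  have hpos : ∀ v ∈ S, 0 < v ⬝ᵥ K.mulVec v := by
    rintro v ⟨hv, hs⟩
    refine hK v hv ?_
    rintro rfl
    simp at hs
  obtain ⟨c, hc, hcS⟩ : ∃ c > 0, ∀ v ∈ S, c ≤ v ⬝ᵥ K.mulVec v := by
    rcases S.eq_empty_or_nonempty with h | h
    · exact ⟨1, one_pos, by simp [h]⟩
    · obtain ⟨w, hw, hmin⟩ := hSc.exists_isMinOn h hcont.continuousOn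
      exact ⟨_, hpos w hw, fun v hv => hmin hv⟩
  refine ⟨c, hc, fun v hv => ?_⟩
  rcases eq_or_ne v 0 with rfl | hv0
  · simp
  obtain ⟨i, hi⟩ := Function.ne_iff.mp hv0
  have hs : 0 < ∑ j, v j ^ 2 :=
    Finset.sum_pos' (fun j _ => sq_nonneg _) ⟨i, Finset.mem_univ i, by
      have : v i ≠ 0 := hi
      positivity⟩
  set s := ∑ j, v j ^ 2 with hsdef
  have hss : √s ^ 2 = s := Real.sq_sqrt hs.le
  have hmem : (√s)⁻¹ • v ∈ S := by
    refine ⟨fun j => ?_, ?_⟩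
    · exact mul_nonneg (by positivity) (hv j)
    · simp only [Pi.smul_apply, smul_eq_mul, mul_pow, ← Finset.mul_sum, ← hsdef, inv_pow, hss]
      exact inv_mul_cancel₀ hs.ne'
  have h := hcS _ hmem
  rw [mulVec_smul, smul_dotProduct, dotProduct_smul, smul_eq_mul, smul_eq_mul, ← mul_assoc,
    ← mul_inv, ← sq, hss, inv_mul_eq_div, le_div_iff₀ hs] at h
  exact h

/-- A positive multiple of a larger power dominates any multiple of a smaller one, up to an
additive constant. -/
theorem exists_mul_rpow_le_mul_rpow_add {b p : ℝ} (hb : 0 ≤ b) (hbp : b < p) {d : ℝ} (hd : 0 < d)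
    (q : ℝ) : ∃ C, ∀ x : ℝ, 0 < x → q * x ^ b ≤ d * x ^ p + C := by
  set T := (|q| / d) ^ (p - b)⁻¹ with hT
  have hT0 : 0 ≤ T := by positivity
  have hpb : 0 < p - b := sub_pos.mpr hbp
  refine ⟨|q| * T ^ b, fun x hx => ?_⟩
  refine (mul_le_mul_of_nonneg_right (le_abs_self q) (by positivity)).trans ?_
  rcases le_total T x with h | h
  · have h1 : |q| / d ≤ x ^ (p - b) := by
      have h2 := Real.rpow_le_rpow hT0 h hpb.le
      rwa [hT, Real.rpow_inv_rpow (by positivity) hpb.ne'] at h2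
    have h3 : x ^ p = x ^ (p - b) * x ^ b := by
      rw [← Real.rpow_add hx, sub_add_cancel]
    rw [div_le_iff₀ hd] at h1
    have h4 := mul_le_mul_of_nonneg_right h1 (Real.rpow_nonneg hx.le b)
    have h5 : 0 ≤ |q| * T ^ b := by positivity
    rw [h3]
    linarith
  · have h1 := mul_le_mul_of_nonneg_left (Real.rpow_le_rpow hx.le h hb) (abs_nonneg q)
    have h2 : 0 ≤ d * x ^ p := by positivity
    linarith

theorem integrableOn_exp_neg_mul_rpow {p d : ℝ} (hp : 0 < p) (hd : 0 < d) :
    IntegrableOn (fun x : ℝ => Real.exp (-d * x ^ p)) (Set.Ioi 0) := by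
  simpa using integrableOn_rpow_mul_exp_neg_mul_rpow (s := 0) (by norm_num) hp hd

theorem integrableOn_exp_neg_mul_rpow_add_mul_rpow {b p d : ℝ} (hb : 0 ≤ b) (hbp : b < p)
    (hd : 0 < d) (q r : ℝ) :
    IntegrableOn (fun x : ℝ => Real.exp (-d * x ^ p + q * x ^ b + r)) (Set.Ioi 0) := by
  obtain ⟨C, hC⟩ := exists_mul_rpow_le_mul_rpow_add hb hbp (half_pos hd) q
  refine ((integrableOn_exp_neg_mul_rpow (hb.trans_lt hbp) (half_pos hd)).const_mul
    (Real.exp (C + r))).mono' (by fun_prop) ?_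
  filter_upwards [ae_restrict_mem measurableSet_Ioi] with x hx
  rw [Real.norm_eq_abs, Real.abs_exp, ← Real.exp_add, Real.exp_le_exp]
  linarith [hC x hx]

/-- For a strictly co-positive interaction matrix `K` and exponents `2a > b > 0`, the
pairwise interaction power density is integrable over the positive orthant for any `η`. -/
theorem stmt_5 (m : ℕ) (hm : 1 ≤ m)
    (K : Matrix (Fin m) (Fin m) ℝ)
    (hK : ∀ v : Fin m → ℝ, (∀ j, 0 ≤ v j) → v ≠ 0 → 0 < v ⬝ᵥ K.mulVec v)
    (a b : ℝ) (hb : 0 < b) (hab : b < 2 * a) (η : Fin m → ℝ) :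
    IntegrableOn
      (fun x : Fin m → ℝ => Real.exp (-(1/(2*a)) *
          ((fun j => x j ^ a) ⬝ᵥ K.mulVec (fun j => x j ^ a))
        + ∑ j, η j * ((x j ^ b - 1) / b)))
      {x : Fin m → ℝ | ∀ j, 0 < x j} := by
  obtain ⟨c, hc, hcK⟩ := exists_pos_mul_sum_sq_le_of_strictly_copositive K hK
  have ha : 0 < 2 * a := hb.trans hab
  have hset : {x : Fin m → ℝ | ∀ j, 0 < x j} = Set.univ.pi fun _ => Set.Ioi 0 := by
    ext x
    simp
  have hmeas : MeasurableSet {x : Fin m → ℝ | ∀ j, 0 < x j} := by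
    rw [hset]
    exact MeasurableSet.univ_pi fun _ => measurableSet_Ioi
  have hprod : IntegrableOn (fun x : Fin m → ℝ => ∏ j,
      Real.exp (-(c / (2 * a)) * x j ^ (2 * a) + η j / b * x j ^ b + -(η j / b)))
      {x : Fin m → ℝ | ∀ j, 0 < x j} := by
    rw [IntegrableOn, hset, volume_pi, Measure.restrict_pi_pi]
    exact Integrable.fintype_prod fun j =>
      integrableOn_exp_neg_mul_rpow_add_mul_rpow hb.le hab (div_pos hc ha) _ _
  refine hprod.mono' ?_ ?_
  · simp only [dotProduct, mulVec]
    exact Measurable.aestronglyMeasurable (by fun_prop)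
  filter_upwards [ae_restrict_mem hmeas] with x hx
  rw [Real.norm_eq_abs, Real.abs_exp, ← Real.exp_sum, Real.exp_le_exp]
  have hsq : ∑ j, (x j ^ a) ^ 2 = ∑ j, x j ^ (2 * a) :=
    Finset.sum_congr rfl fun j _ => by
      rw [mul_comm, Real.rpow_mul (hx j).le, Real.rpow_two]
  have hquad := hcK (fun j => x j ^ a) fun j => Real.rpow_nonneg (hx j).le a
  rw [hsq] at hquad
  have hscaled := mul_le_mul_of_nonneg_left hquad (one_div_pos.mpr ha).le
  have hsum : ∑ j, (-(c / (2 * a)) * x j ^ (2 * a) + η j / b * x j ^ b + -(η j / b)) =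
      -(1 / (2 * a) * (c * ∑ j, x j ^ (2 * a))) + ∑ j, η j * ((x j ^ b - 1) / b) := by
    rw [Finset.mul_sum, Finset.mul_sum, ← Finset.sum_neg_distrib, ← Finset.sum_add_distrib]
    exact Finset.sum_congr rfl fun j _ => by ring
  rw [hsum]
  linarith
end

section
/- Let m ≥ 1, let K ∈ ℝ^{m×m} be strictly co-positive, i.e. vᵀKv > 0 for every v ∈ [0,∞)^m with v ≠ 0, let a > 0, and let η ∈ ℝ^m satisfy η_j > −1 for all j. Then the function x ↦ exp( −(1/(2a)) (x^a)ᵀ K x^a + Σ_{j=1}^m η_j log x_j ) is Lebesgue integrable over (0,∞)^m, where x^a denotes the componentwise power (x₁^a, …, x_m^a). In particular (taking η = 0), for any strictly co-positive K and any a > 0 the function x ↦ exp( −(1/(2a)) (x^a)ᵀ K x^a ) is integrable over (0,∞)^m. -/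
open MeasureTheory Matrix

theorem exists_pos_mul_sum_sq_le_of_strictlyCopositive {ι : Type*} [Fintype ι]
    (K : Matrix ι ι ℝ)
    (hK : ∀ v : ι → ℝ, (∀ j, 0 ≤ v j) → v ≠ 0 → 0 < v ⬝ᵥ K.mulVec v) :
    ∃ c : ℝ, 0 < c ∧ ∀ v : ι → ℝ, (∀ j, 0 ≤ v j) → c * ∑ j, v j ^ 2 ≤ v ⬝ᵥ K.mulVec v := by
  classical
  rcases isEmpty_or_nonempty ι with hι | ⟨⟨i⟩⟩
  · exact ⟨1, one_pos, fun v _ => by simp [dotProduct]⟩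
  have hcont : Continuous fun v : ι → ℝ => v ⬝ᵥ K.mulVec v := by fun_prop
  obtain ⟨w, hw, hmin⟩ := (isCompact_stdSimplex ℝ ι).exists_isMinOn
    ⟨_, single_mem_stdSimplex ℝ i⟩ hcont.continuousOn
  have hw0 : w ≠ 0 := by
    rintro rfl
    simpa using hw.2
  refine ⟨w ⬝ᵥ K.mulVec w, hK w hw.1 hw0, fun v hv => ?_⟩
  rcases eq_or_ne v 0 with rfl | hv0
  · simp
  have hs : 0 < ∑ j, v j := by
    obtain ⟨j, hj⟩ := Function.ne_iff.mp hv0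
    exact Finset.sum_pos' (fun j _ => hv j) ⟨j, Finset.mem_univ j, (hv j).lt_of_ne' hj⟩
  set s := ∑ j, v j with hs_def
  have hmem : s⁻¹ • v ∈ stdSimplex ℝ ι := by
    refine ⟨fun j => mul_nonneg (inv_nonneg.2 hs.le) (hv j), ?_⟩
    simp [← Finset.mul_sum, ← hs_def, hs.ne']
  have hle : w ⬝ᵥ K.mulVec w ≤ (s⁻¹ • v) ⬝ᵥ K.mulVec (s⁻¹ • v) := hmin hmem
  have hQ : s ^ 2 * ((s⁻¹ • v) ⬝ᵥ K.mulVec (s⁻¹ • v)) = v ⬝ᵥ K.mulVec v := by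
    simp only [mulVec_smul, smul_dotProduct, dotProduct_smul, smul_eq_mul]
    field_simp
  have hsq : ∑ j, v j ^ 2 ≤ s ^ 2 := Finset.sum_sq_le_sq_sum_of_nonneg fun j _ => hv j
  calc (w ⬝ᵥ K.mulVec w) * ∑ j, v j ^ 2
      ≤ (w ⬝ᵥ K.mulVec w) * s ^ 2 := by
        gcongr
        exact (hK w hw.1 hw0).le
    _ ≤ s ^ 2 * ((s⁻¹ • v) ⬝ᵥ K.mulVec (s⁻¹ • v)) := by
        rw [mul_comm]
        gcongr
    _ = v ⬝ᵥ K.mulVec v := hQ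

theorem integrableOn_prod_rpow_mul_exp_neg_mul_rpow {ι : Type*} [Fintype ι] {p b : ℝ}
    (hp : 0 < p) (hb : 0 < b) {η : ι → ℝ} (hη : ∀ j, -1 < η j) :
    IntegrableOn (fun x : ι → ℝ => ∏ j, (x j ^ η j * Real.exp (-b * x j ^ p)))
      {x : ι → ℝ | ∀ j, 0 < x j} := by
  have hset : {x : ι → ℝ | ∀ j, 0 < x j} = Set.univ.pi fun _ => Set.Ioi 0 := by
    ext x
    simp
  rw [hset, IntegrableOn, volume_pi, Measure.restrict_pi_pi]
  exact Integrable.fintype_prod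
    (f := fun j (t : ℝ) => t ^ η j * Real.exp (-b * t ^ p)) fun j =>
      integrableOn_rpow_mul_exp_neg_mul_rpow (hη j) hp hb

theorem integrableOn_exp_neg_quadraticForm_rpow_add_sum_log {ι : Type*} [Fintype ι]
    (K : Matrix ι ι ℝ)
    (hK : ∀ v : ι → ℝ, (∀ j, 0 ≤ v j) → v ≠ 0 → 0 < v ⬝ᵥ K.mulVec v)
    {a : ℝ} (ha : 0 < a) {η : ι → ℝ} (hη : ∀ j, -1 < η j) :
    IntegrableOn
      (fun x : ι → ℝ => Real.exp (-(1/(2*a)) *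
          ((fun j => x j ^ a) ⬝ᵥ K.mulVec (fun j => x j ^ a))
        + ∑ j, η j * Real.log (x j)))
      {x : ι → ℝ | ∀ j, 0 < x j} := by
  obtain ⟨c, hc, hcK⟩ := exists_pos_mul_sum_sq_le_of_strictlyCopositive K hK
  have hmeas : MeasurableSet {x : ι → ℝ | ∀ j, 0 < x j} := by
    simp only [Set.ofPred_forall]
    exact MeasurableSet.iInter fun j => measurableSet_lt measurable_const (measurable_pi_apply j)
  refine (integrableOn_prod_rpow_mul_exp_neg_mul_rpow (p := a * 2) (b := 1/(2*a) * c)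
    (by positivity) (by positivity) hη).mono' ?_ ?_
  · refine Measurable.aestronglyMeasurable ?_
    simp only [dotProduct, mulVec]
    fun_prop
  · refine (ae_restrict_mem hmeas).mono fun x hx => ?_
    have hprod : ∏ j, (x j ^ η j * Real.exp (-(1/(2*a) * c) * x j ^ (a * 2)))
        = Real.exp (-(1/(2*a)) * (c * ∑ j, (x j ^ a) ^ 2) + ∑ j, η j * Real.log (x j)) := by
      rw [Finset.mul_sum, Finset.mul_sum, ← Finset.sum_add_distrib, Real.exp_sum]
      refine Finset.prod_congr rfl fun j _ => ?_
      rw [Real.rpow_def_of_pos (hx j) (η j), ← Real.exp_add, Real.rpow_mul (hx j).le,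
        Real.rpow_two]
      ring_nf
    rw [hprod, Real.norm_eq_abs, Real.abs_exp, Real.exp_le_exp, neg_mul, neg_mul]
    gcongr
    exact hcK _ fun j => Real.rpow_nonneg (hx j).le a

/-- For a strictly co-positive interaction matrix `K`, `a > 0`, and `η ≻ -1`, the log-linear
pairwise interaction power density is integrable over the positive orthant; in particular,
the centered density (η = 0) is integrable. -/
theorem stmt_6 (m : ℕ) (hm : 1 ≤ m)
    (K : Matrix (Fin m) (Fin m) ℝ)
    (hK : ∀ v : Fin m → ℝ, (∀ j, 0 ≤ v j) → v ≠ 0 → 0 < v ⬝ᵥ K.mulVec v)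
    (a : ℝ) (ha : 0 < a) (η : Fin m → ℝ) (hη : ∀ j, -1 < η j) :
    IntegrableOn
      (fun x : Fin m → ℝ => Real.exp (-(1/(2*a)) *
          ((fun j => x j ^ a) ⬝ᵥ K.mulVec (fun j => x j ^ a))
        + ∑ j, η j * Real.log (x j)))
      {x : Fin m → ℝ | ∀ j, 0 < x j} ∧
    IntegrableOn
      (fun x : Fin m → ℝ => Real.exp (-(1/(2*a)) *
          ((fun j => x j ^ a) ⬝ᵥ K.mulVec (fun j => x j ^ a))))
      {x : Fin m → ℝ | ∀ j, 0 < x j} := by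
  refine ⟨integrableOn_exp_neg_quadraticForm_rpow_add_sum_log K hK ha hη, ?_⟩
  simpa using integrableOn_exp_neg_quadraticForm_rpow_add_sum_log K hK ha
    (η := fun _ => 0) fun _ => by norm_num
end

section
/- Let μ ∈ ℝ^m, let Σ ∈ ℝ^{m×m} be symmetric positive definite, and let ν be the truncated normal distribution TN(μ, Σ⁻¹) on the non-negative orthant. Let X = (X₁,…,X_m) be a random vector with law ν. Then for every j ∈ {1,…,m}, X_j is integrable and for all t ∈ ℝ, E[ exp( t (X_j − E X_j) ) ] ≤ exp( t² Σ_{jj} / 2 ); that is, the centered j-th marginal of ν is sub-Gaussian with sub-Gaussian parameter at most √(Σ_{jj}). -/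
open MeasureTheory Matrix

/-- The truncated normal distribution `TN(μ0, S⁻¹)` on the non-negative orthant: the
probability measure with density proportional to `exp(-(1/2)(x-μ0)ᵀ S⁻¹ (x-μ0))` on
`[0,∞)^m`. -/
noncomputable def truncNormal (m : ℕ) (μ0 : Fin m → ℝ) (S : Matrix (Fin m) (Fin m) ℝ) :
    MeasureTheory.Measure (Fin m → ℝ) :=
  (MeasureTheory.volume.restrict {x : Fin m → ℝ | ∀ j, 0 ≤ x j}).withDensity fun x =>
    ENNReal.ofReal (
      (∫ y in {y : Fin m → ℝ | ∀ j, 0 ≤ y j},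
          Real.exp (-(1/2) * ((y - μ0) ⬝ᵥ S⁻¹.mulVec (y - μ0))))⁻¹ *
      Real.exp (-(1/2) * ((x - μ0) ⬝ᵥ S⁻¹.mulVec (x - μ0))))

open ProbabilityTheory
open scoped ENNReal

lemma volume_add_le_of_isCompact {K L C : Set ℝ} (hK : IsCompact K) (hL : IsCompact L)
    (hK0 : K.Nonempty) (hL0 : L.Nonempty) (hC : ∀ a ∈ K, ∀ b ∈ L, (a + b) / 2 ∈ C) :
    volume K + volume L ≤ 2 * volume C := by
  obtain ⟨a, haK, ha⟩ := hK.exists_isGreatest hK0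
  obtain ⟨b, hbL, hb⟩ := hL.exists_isLeast hL0
  have hD : volume ((fun x : ℝ => 2⁻¹ * x) ⁻¹' C) = 2 * volume C := by
    rw [Real.volume_preimage_mul_left (by norm_num)]
    simp
  have h1 : volume ((fun x : ℝ => x - b) ⁻¹' K) = volume K := by
    simp [sub_eq_add_neg]
  have h2 : volume ((fun x : ℝ => x - a) ⁻¹' L) = volume L := by
    simp [sub_eq_add_neg]
  rw [← hD, ← h1, ← h2, ← measure_union₀]
  · refine measure_mono ?_
    rintro x (hx | hx)
    · have := hC _ hx b hbL
      simp only [Set.mem_preimage]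
      convert this using 1; ring
    · have := hC a haK _ hx
      simp only [Set.mem_preimage]
      convert this using 1; ring
  · exact (hL.measurableSet.preimage (by fun_prop)).nullMeasurableSet
  · refine measure_mono_null (t := {a + b}) ?_ (by simp)
    rintro x ⟨hx, hx'⟩
    have h3 := ha hx
    have h4 := hb hx'
    simp only [Set.mem_singleton_iff]
    linarith

/-- The one-dimensional Brunn–Minkowski inequality, for midpoints. -/
lemma volume_add_le_two_mul_volume {A B C : Set ℝ} (hA : MeasurableSet A) (hB : MeasurableSet B)
    (hA0 : A.Nonempty) (hB0 : B.Nonempty) (hC : ∀ a ∈ A, ∀ b ∈ B, (a + b) / 2 ∈ C) :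
    volume A + volume B ≤ 2 * volume C := by
  obtain ⟨a, ha⟩ := hA0
  obtain ⟨b, hb⟩ := hB0
  have key : ∀ K, K ⊆ A ∧ IsCompact K → ∀ L, L ⊆ B ∧ IsCompact L →
      volume K + volume L ≤ 2 * volume C := by
    rintro K ⟨hKA, hK⟩ L ⟨hLB, hL⟩
    calc volume K + volume L ≤ volume (insert a K) + volume (insert b L) := by
          gcongr <;> exact Set.subset_insert _ _
      _ ≤ 2 * volume C := by
          refine volume_add_le_of_isCompact (hK.insert a) (hL.insert b) ⟨a, by simp⟩ ⟨b, by simp⟩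
            fun x hx y hy => hC x ?_ y ?_
          · exact Set.insert_subset ha hKA hx
          · exact Set.insert_subset hb hLB hy
  rw [hA.measure_eq_iSup_isCompact, hB.measure_eq_iSup_isCompact]
  simp only [iSup_and']
  exact ENNReal.biSup_add_biSup_le' ⟨∅, by simp⟩ ⟨∅, by simp⟩ key

lemma lintegral_eq_lintegral_Ioo_meas_lt {f : ℝ → ℝ≥0∞} (hf : Measurable f) (hf1 : ∀ x, f x ≤ 1) :
    ∫⁻ x, f x = ∫⁻ t in Set.Ioo (0 : ℝ) 1, volume {x | ENNReal.ofReal t < f x} := by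
  have hfin : ∀ x, f x ≠ ∞ := fun x => ((hf1 x).trans_lt ENNReal.one_lt_top).ne
  have h := lintegral_eq_lintegral_meas_lt (μ := volume) (f := fun x => (f x).toReal)
    (Filter.Eventually.of_forall fun x => ENNReal.toReal_nonneg) hf.ennreal_toReal.aemeasurable
  simp only [ENNReal.ofReal_toReal (hfin _)] at h
  rw [h, ← Set.Ioo_union_Ici_eq_Ioi (zero_lt_one' ℝ), lintegral_union measurableSet_Ici]
  · rw [setLIntegral_congr_fun (s := Set.Ici 1) (g := fun _ => 0) measurableSet_Ici]
    · simp only [lintegral_zero, add_zero]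
      refine setLIntegral_congr_fun measurableSet_Ioo fun t ht => ?_
      congr 1
      ext x
      exact (ENNReal.ofReal_lt_iff_lt_toReal ht.1.le (hfin x)).symm
    · intro t ht
      simp only
      convert measure_empty (μ := (volume : Measure ℝ))
      ext x
      simp only [Set.mem_ofPred_eq, Set.mem_empty_iff_false, iff_false, not_lt]
      exact (ENNReal.toReal_mono ENNReal.one_ne_top (hf1 x)).trans (by simpa using ht)
  · exact Set.disjoint_left.2 fun x hx hx' => absurd hx.2 (not_lt.2 hx')

lemma lintegral_add_le_of_iSup_eq_one {f g h : ℝ → ℝ≥0∞} (hf : Measurable f) (hg : Measurable g)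
    (hh : Measurable h) (hf1 : ⨆ x, f x = 1) (hg1 : ⨆ x, g x = 1)
    (H : ∀ x y, f x * g y ≤ h ((x + y) / 2) ^ 2) :
    (∫⁻ x, f x) + ∫⁻ x, g x ≤ 2 * ∫⁻ x, h x := by
  have hf' : ∀ x, f x ≤ 1 := fun x => hf1 ▸ le_iSup f x
  have hg' : ∀ x, g x ≤ 1 := fun x => hg1 ▸ le_iSup g x
  have hm : Measurable fun x => min (h x) 1 := hh.min measurable_const
  have hmeas : ∀ u : ℝ → ℝ≥0∞, Measurable fun t : ℝ => volume {x | ENNReal.ofReal t < u x} := by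
    intro u
    refine Antitone.measurable fun s t hst => measure_mono fun x hx => ?_
    exact (ENNReal.ofReal_le_ofReal hst).trans_lt hx
  calc (∫⁻ x, f x) + ∫⁻ x, g x ≤ 2 * ∫⁻ x, min (h x) 1 := by
        rw [lintegral_eq_lintegral_Ioo_meas_lt hf hf', lintegral_eq_lintegral_Ioo_meas_lt hg hg',
          lintegral_eq_lintegral_Ioo_meas_lt hm fun x => min_le_right _ _,
          ← lintegral_add_left (hmeas f), ← lintegral_const_mul _ (hmeas _)]
        refine setLIntegral_mono' measurableSet_Ioo fun t ht => ?_
        have ht1 : ENNReal.ofReal t < 1 := by simpa using ht.2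
        have hne : ∀ u : ℝ → ℝ≥0∞, ⨆ x, u x = 1 → {x | ENNReal.ofReal t < u x}.Nonempty := by
          intro u hu
          obtain ⟨x, hx⟩ := lt_iSup_iff.1 (hu ▸ ht1)
          exact ⟨x, hx⟩
        refine volume_add_le_two_mul_volume (measurableSet_lt measurable_const hf)
          (measurableSet_lt measurable_const hg) (hne f hf1) (hne g hg1) fun a ha b hb => ?_
        refine lt_min ?_ ht1
        by_contra! hc
        have h1 : h ((a + b) / 2) ^ 2 ≤ ENNReal.ofReal t * ENNReal.ofReal t := by
          rw [sq]; gcongr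
        exact absurd ((H a b).trans h1) (not_le.2 (ENNReal.mul_lt_mul ha hb))
    _ ≤ 2 * ∫⁻ x, h x := by gcongr; exact min_le_left _ _

lemma four_mul_le_sq_add_ennreal (a b : ℝ≥0∞) : 4 * (a * b) ≤ (a + b) ^ 2 := by
  induction a with
  | top => simp
  | coe a =>
    induction b with
    | top => simp
    | coe b =>
      norm_cast
      rw [← NNReal.coe_le_coe]
      push_cast
      nlinarith [sq_nonneg ((a : ℝ) - b)]

lemma prekopa_leindler_real_of_iSup_ne_top {f g h : ℝ → ℝ≥0∞} (hf : Measurable f)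
    (hg : Measurable g) (hh : Measurable h) (hft : ⨆ x, f x ≠ ∞) (hgt : ⨆ x, g x ≠ ∞)
    (H : ∀ x y, f x * g y ≤ h ((x + y) / 2) ^ 2) :
    (∫⁻ x, f x) * ∫⁻ x, g x ≤ (∫⁻ x, h x) ^ 2 := by
  set A := ⨆ x, f x with hA
  set B := ⨆ x, g x with hB
  by_cases hA0 : A = 0
  · have : ∀ x, f x = 0 := by simpa [hA] using hA0
    simp [this]
  by_cases hB0 : B = 0
  · have : ∀ x, g x = 0 := by simpa [hB] using hB0
    simp [this]
  obtain ⟨c, hc⟩ : ∃ c : ℝ≥0∞, c ^ 2 = A * B :=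
    ⟨(A * B) ^ (1 / 2 : ℝ), by rw [← ENNReal.rpow_natCast, ← ENNReal.rpow_mul]; norm_num⟩
  have hAB0 : A * B ≠ 0 := mul_ne_zero hA0 hB0
  have hABt : A * B ≠ ∞ := ENNReal.mul_ne_top hft hgt
  have hc0 : c ≠ 0 := by rintro rfl; simp at hc; tauto
  have hct : c ≠ ∞ := by rintro rfl; simp at hc; exact hABt hc.symm
  have key := lintegral_add_le_of_iSup_eq_one (f := fun x => A⁻¹ * f x) (g := fun x => B⁻¹ * g x)
    (h := fun x => c⁻¹ * h x) (hf.const_mul _) (hg.const_mul _) (hh.const_mul _)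
    (by rw [← ENNReal.mul_iSup, ENNReal.inv_mul_cancel hA0 hft])
    (by rw [← ENNReal.mul_iSup, ENNReal.inv_mul_cancel hB0 hgt])
    (fun x y => by
      calc A⁻¹ * f x * (B⁻¹ * g y) = (A * B)⁻¹ * (f x * g y) := by
            rw [ENNReal.mul_inv (Or.inl hA0) (Or.inl hft)]; ring
        _ ≤ (A * B)⁻¹ * h ((x + y) / 2) ^ 2 := by gcongr; exact H x y
        _ = _ := by rw [mul_pow, ← hc, ENNReal.inv_pow])
  rw [lintegral_const_mul _ hf, lintegral_const_mul _ hg, lintegral_const_mul _ hh] at key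
  have h2 := (four_mul_le_sq_add_ennreal _ _).trans (pow_le_pow_left' key 2)
  rw [mul_pow, mul_pow, ← ENNReal.inv_pow, hc] at h2
  have h3 : A⁻¹ * (∫⁻ x, f x) * (B⁻¹ * ∫⁻ x, g x) = (A * B)⁻¹ * ((∫⁻ x, f x) * ∫⁻ x, g x) := by
    rw [ENNReal.mul_inv (Or.inl hA0) (Or.inl hft)]; ring
  rw [h3, show (2 : ℝ≥0∞) ^ 2 = 4 by norm_num,
    ENNReal.mul_le_mul_iff_right (by norm_num) (by norm_num),
    ENNReal.mul_le_mul_iff_right (by simpa using hABt) (by simpa using ⟨hA0, hB0⟩)] at h2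
  exact h2

/-- The one-dimensional Prékopa–Leindler inequality, for midpoints. -/
lemma prekopa_leindler_real {f g h : ℝ → ℝ≥0∞} (hf : Measurable f)
    (hg : Measurable g) (hh : Measurable h) (H : ∀ x y, f x * g y ≤ h ((x + y) / 2) ^ 2) :
    (∫⁻ x, f x) * ∫⁻ x, g x ≤ (∫⁻ x, h x) ^ 2 := by
  have trunc : ∀ u : ℝ → ℝ≥0∞, Measurable u →
      ∫⁻ x, u x = ⨆ n : ℕ, ∫⁻ x, min (u x) n := by
    intro u hu
    rw [← lintegral_iSup (fun n => hu.min measurable_const)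
      (fun m n hmn x => min_le_min le_rfl (by simpa using hmn))]
    refine lintegral_congr fun x => ?_
    rw [← inf_iSup_eq, ENNReal.iSup_natCast, inf_top_eq]
  rw [trunc f hf, trunc g hg, ENNReal.iSup_mul]
  refine iSup_le fun n => ?_
  rw [ENNReal.mul_iSup]
  refine iSup_le fun k => ?_
  refine prekopa_leindler_real_of_iSup_ne_top (hf.min measurable_const) (hg.min measurable_const)
    hh ?_ ?_ fun x y => (mul_le_mul' (min_le_left _ _) (min_le_left _ _)).trans (H x y)
  · exact ((iSup_le fun x => min_le_right _ _).trans_lt (ENNReal.natCast_lt_top n)).ne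
  · exact ((iSup_le fun x => min_le_right _ _).trans_lt (ENNReal.natCast_lt_top k)).ne

/-- The Prékopa–Leindler inequality on `ℝⁿ`, for midpoints. -/
lemma prekopa_leindler {n : ℕ} {f g h : (Fin n → ℝ) → ℝ≥0∞} (hf : Measurable f)
    (hg : Measurable g) (hh : Measurable h)
    (H : ∀ x y, f x * g y ≤ h ((2⁻¹ : ℝ) • (x + y)) ^ 2) :
    (∫⁻ x, f x) * ∫⁻ x, g x ≤ (∫⁻ x, h x) ^ 2 := by
  induction n with
  | zero =>
    rw [volume_pi, Measure.pi_of_empty]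
    simp only [lintegral_dirac]
    convert H _ _
  | succ n ih =>
    let e := (MeasurableEquiv.piFinSuccAbove (fun _ : Fin (n + 1) => ℝ) 0).symm
    have he : ∀ (a : ℝ) (x : Fin n → ℝ), e (a, x) = Fin.cons a x := by
      intro a x
      simp [e, MeasurableEquiv.piFinSuccAbove]
      rfl
    have fub : ∀ u : (Fin (n + 1) → ℝ) → ℝ≥0∞, Measurable u →
        ∫⁻ x, u x = ∫⁻ a : ℝ, ∫⁻ x : Fin n → ℝ, u (e (a, x)) := by
      intro u hu
      rw [← ((volume_preserving_piFinSuccAbove (fun _ : Fin (n + 1) => ℝ) 0).symm _).lintegral_comp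
        hu, Measure.volume_eq_prod, lintegral_prod _ (by fun_prop)]
    have hm : ∀ u : (Fin (n + 1) → ℝ) → ℝ≥0∞, Measurable u →
        Measurable fun a : ℝ => ∫⁻ x : Fin n → ℝ, u (e (a, x)) := fun u hu =>
      Measurable.lintegral_prod_right' (f := fun p => u (e p)) (by fun_prop)
    rw [fub f hf, fub g hg, fub h hh]
    refine prekopa_leindler_real (hm f hf) (hm g hg) (hm h hh) fun a b => ?_
    refine ih (by fun_prop) (by fun_prop) (by fun_prop) fun x y => ?_
    convert H (e (a, x)) (e (b, y)) using 3
    simp only [he]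
    ext i
    refine Fin.cases ?_ (fun i => ?_) i
    · simp; ring
    · simp; ring

lemma mgf_le_of_mgf_half {Ω : Type*} {mΩ : MeasurableSpace Ω} {ν : Measure Ω}
    [IsProbabilityMeasure ν] {X : Ω → ℝ} {σ : ℝ}
    (hint : ∀ t, Integrable (fun x => Real.exp (t * X x)) ν)
    (H : ∀ t, mgf X ν t * Real.exp (-(t ^ 2 * σ / 2)) ≤
      (mgf X ν (t / 2) * Real.exp (-((t / 2) ^ 2 * σ / 2))) ^ 2) (t : ℝ) :
    mgf X ν t ≤ Real.exp (t * (∫ x, X x ∂ν) + t ^ 2 * σ / 2) := by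
  have hpos : ∀ t, 0 < mgf X ν t := fun t => mgf_pos (hint t)
  set g : ℝ → ℝ := fun t => Real.log (mgf X ν t) - t ^ 2 * σ / 2 with hg
  have hg0 : g 0 = 0 := by simp [hg]
  have hhalf : ∀ t, g t ≤ 2 * g (t / 2) := by
    intro t
    have h := Real.log_le_log (mul_pos (hpos t) (Real.exp_pos _)) (H t)
    rw [Real.log_mul (hpos t).ne' (Real.exp_ne_zero _), Real.log_pow,
      Real.log_mul (hpos _).ne' (Real.exp_ne_zero _), Real.log_exp, Real.log_exp] at h
    simp only [hg]
    push_cast at h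
    linarith
  have hiter : ∀ n : ℕ, g t ≤ 2 ^ n * g (t * (1 / 2) ^ n) := by
    intro n
    induction n with
    | zero => simp
    | succ n ih =>
      have h := hhalf (t * (1 / 2) ^ n)
      rw [show t * (1 / 2) ^ (n + 1) = t * (1 / 2) ^ n / 2 by ring, pow_succ, mul_assoc]
      exact ih.trans (by gcongr)
  have hderiv : HasDerivAt (fun u => g (t * u)) (t * ∫ x, X x ∂ν) 0 := by
    have h0 : (0 : ℝ) ∈ interior (integrableExpSet X ν) := by
      have : integrableExpSet X ν = Set.univ := Set.eq_univ_of_forall hint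
      simp [this]
    have h1 : HasDerivAt (mgf X ν) (∫ x, X x ∂ν) 0 := by simpa using hasDerivAt_mgf h0
    have h2 : HasDerivAt g (∫ x, X x ∂ν) 0 := by
      have h3 := (h1.log (hpos 0).ne').sub
        ((((hasDerivAt_id (0 : ℝ)).pow 2).mul_const σ).div_const 2)
      exact HasDerivAt.congr_deriv (f := g) h3 (by simp)
    have h4 : HasDerivAt g (∫ x, X x ∂ν) (t * 0) := by simpa using h2
    have h5 := h4.comp (0 : ℝ) ((hasDerivAt_id (0 : ℝ)).const_mul t)
    exact h5.congr_deriv (by ring)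
  have hlim : Filter.Tendsto (fun n : ℕ => 2 ^ n * g (t * (1 / 2) ^ n)) Filter.atTop
      (nhds (t * ∫ x, X x ∂ν)) := by
    have hseq : Filter.Tendsto (fun n : ℕ => (1 / 2 : ℝ) ^ n) Filter.atTop
        (nhdsWithin 0 {0}ᶜ) :=
      tendsto_nhdsWithin_iff.2 ⟨tendsto_pow_atTop_nhds_zero_of_lt_one (by norm_num) (by norm_num),
        Filter.Eventually.of_forall fun n => by simp⟩
    refine (hderiv.tendsto_slope_zero.comp hseq).congr fun n => ?_
    simp [hg0]
  have hle : g t ≤ t * ∫ x, X x ∂ν := ge_of_tendsto' hlim hiter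
  rw [← Real.log_le_iff_le_exp (hpos t)]
  simp only [hg] at hle
  linarith

section QuadraticForm

variable {m : ℕ} {S : Matrix (Fin m) (Fin m) ℝ}

lemma dotProduct_inv_mulVec_comm (hS : S.PosDef) (u v : Fin m → ℝ) :
    u ⬝ᵥ S⁻¹ *ᵥ v = v ⬝ᵥ S⁻¹ *ᵥ u := by
  have h : (S⁻¹)ᵀ = S⁻¹ := by simpa [IsHermitian] using hS.inv.isHermitian
  rw [dotProduct_mulVec, ← mulVec_transpose, h, dotProduct_comm]

lemma dotProduct_inv_mulVec_self_nonneg (hS : S.PosDef) (u : Fin m → ℝ) :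
    0 ≤ u ⬝ᵥ S⁻¹ *ᵥ u := by
  simpa using hS.inv.posSemidef.dotProduct_mulVec_nonneg u

lemma two_mul_inv_quadratic_midpoint_le (hS : S.PosDef) (u v : Fin m → ℝ) :
    2 * (((2⁻¹ : ℝ) • (u + v)) ⬝ᵥ S⁻¹ *ᵥ ((2⁻¹ : ℝ) • (u + v))) ≤
      u ⬝ᵥ S⁻¹ *ᵥ u + v ⬝ᵥ S⁻¹ *ᵥ v := by
  have h := dotProduct_inv_mulVec_self_nonneg hS (u - v)
  have hc := dotProduct_inv_mulVec_comm hS u v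
  simp only [mulVec_smul, mulVec_add, mulVec_sub, dotProduct_add, dotProduct_sub, add_dotProduct,
    sub_dotProduct, dotProduct_smul, smul_dotProduct, smul_eq_mul] at h ⊢
  linarith

lemma inv_quadratic_sub_smul_col (hS : S.PosDef) (z : Fin m → ℝ) (s : ℝ) (j : Fin m) :
    (z - s • S.col j) ⬝ᵥ S⁻¹ *ᵥ (z - s • S.col j) =
      z ⬝ᵥ S⁻¹ *ᵥ z - 2 * s * z j + s ^ 2 * S j j := by
  have hc := dotProduct_inv_mulVec_comm hS (S.col j) z
  have hcol : S⁻¹ *ᵥ S.col j = Pi.single j 1 := by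
    rw [← mulVec_single_one, mulVec_mulVec, nonsing_inv_mul _ hS.det_pos.ne'.isUnit, one_mulVec]
  rw [hcol] at hc
  simp only [mulVec_smul, mulVec_sub, dotProduct_sub, sub_dotProduct, dotProduct_smul,
    smul_dotProduct, smul_eq_mul, hcol, hc]
  simp only [dotProduct_single, mul_one, col_apply]
  ring

lemma sq_div_le_inv_quadratic (hS : S.PosDef) (z : Fin m → ℝ) (j : Fin m) :
    (S j j)⁻¹ * z j ^ 2 ≤ z ⬝ᵥ S⁻¹ *ᵥ z := by
  have h := inv_quadratic_sub_smul_col hS z (z j / S j j) j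
  have h0 := dotProduct_inv_mulVec_self_nonneg hS (z - (z j / S j j) • S.col j)
  have hj : 0 < S j j := hS.diag_pos
  have h1 : 2 * (z j / S j j) * z j - (z j / S j j) ^ 2 * S j j = (S j j)⁻¹ * z j ^ 2 := by
    field_simp; ring
  linarith

lemma integrable_exp_neg_half_inv_quadratic (hm : 1 ≤ m) (hS : S.PosDef) :
    Integrable fun z : Fin m → ℝ => Real.exp (-(1/2) * (z ⬝ᵥ S⁻¹ *ᵥ z)) := by
  have hm0 : (0 : ℝ) < m := by exact_mod_cast hm
  have h1 : Integrable fun z : Fin m → ℝ =>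
      ∏ i, Real.exp (-((S i i)⁻¹ / (2 * m)) * z i ^ 2) := by
    refine Integrable.fintype_prod (f := fun i x => Real.exp (-((S i i)⁻¹ / (2 * m)) * x ^ 2))
      fun i => integrable_exp_neg_mul_sq ?_
    have : 0 < S i i := hS.diag_pos
    positivity
  refine h1.mono' (by fun_prop) (Filter.Eventually.of_forall fun z => ?_)
  rw [Real.norm_eq_abs, Real.abs_exp, ← Real.exp_sum]
  refine Real.exp_le_exp.2 ?_
  have h2 : ∑ i, (S i i)⁻¹ * z i ^ 2 ≤ ∑ _i : Fin m, z ⬝ᵥ S⁻¹ *ᵥ z :=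
    Finset.sum_le_sum fun i _ => sq_div_le_inv_quadratic hS z i
  have h3 : ∑ i, -((S i i)⁻¹ / (2 * m)) * z i ^ 2 =
      -(1 / (2 * m)) * ∑ i, (S i i)⁻¹ * z i ^ 2 := by
    rw [Finset.mul_sum]
    exact Finset.sum_congr rfl fun i _ => by field_simp
  rw [h3]
  simp only [Finset.sum_const, Finset.card_univ, Fintype.card_fin, nsmul_eq_mul] at h2
  have h4 := mul_le_mul_of_nonneg_left h2 (by positivity : (0 : ℝ) ≤ 1 / (2 * m))
  have h5 : 1 / (2 * (m : ℝ)) * (m * (z ⬝ᵥ S⁻¹ *ᵥ z)) = (1/2) * (z ⬝ᵥ S⁻¹ *ᵥ z) := by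
    field_simp
  linarith

end QuadraticForm

section Tilt

variable {m : ℕ} {S : Matrix (Fin m) (Fin m) ℝ}

/-- The mass that the Gaussian density translated by `t` times the `j`-th column of `S` gives to
the non-negative orthant. -/
noncomputable def orthantMass (μ0 : Fin m → ℝ) (S : Matrix (Fin m) (Fin m) ℝ) (j : Fin m)
    (t : ℝ) : ℝ :=
  ∫ x in {x : Fin m → ℝ | ∀ j, 0 ≤ x j},
    Real.exp (-(1/2) * ((x - μ0 - t • S.col j) ⬝ᵥ S⁻¹ *ᵥ (x - μ0 - t • S.col j)))

lemma measurableSet_orthant : MeasurableSet {x : Fin m → ℝ | ∀ j, 0 ≤ x j} := by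
  simp only [Set.ofPred_forall]
  exact MeasurableSet.iInter fun i => measurableSet_le measurable_const (measurable_pi_apply i)

lemma integrable_exp_neg_half_translate (hm : 1 ≤ m) (hS : S.PosDef) (μ0 : Fin m → ℝ) (j : Fin m)
    (t : ℝ) : Integrable fun x : Fin m → ℝ =>
      Real.exp (-(1/2) * ((x - μ0 - t • S.col j) ⬝ᵥ S⁻¹ *ᵥ (x - μ0 - t • S.col j))) := by
  simpa only [sub_sub] using
    (integrable_exp_neg_half_inv_quadratic hm hS).comp_sub_right (μ0 + t • S.col j)

lemma ofReal_orthantMass (hm : 1 ≤ m) (hS : S.PosDef) (μ0 : Fin m → ℝ) (j : Fin m) (t : ℝ) :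
    ENNReal.ofReal (orthantMass μ0 S j t) =
      ∫⁻ x, {x : Fin m → ℝ | ∀ j, 0 ≤ x j}.indicator (fun x => ENNReal.ofReal (Real.exp
        (-(1/2) * ((x - μ0 - t • S.col j) ⬝ᵥ S⁻¹ *ᵥ (x - μ0 - t • S.col j))))) x := by
  rw [orthantMass, ofReal_integral_eq_lintegral_ofReal
    (integrable_exp_neg_half_translate hm hS μ0 j t).integrableOn
    (Filter.Eventually.of_forall fun x => (Real.exp_pos _).le),
    lintegral_indicator measurableSet_orthant]

lemma orthantMass_nonneg (μ0 : Fin m → ℝ) (j : Fin m) (t : ℝ) : 0 ≤ orthantMass μ0 S j t :=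
  integral_nonneg fun _ => (Real.exp_pos _).le

/-- The orthant mass is midpoint log-concave in the translation parameter. -/
lemma orthantMass_mul_le (hm : 1 ≤ m) (hS : S.PosDef) (μ0 : Fin m → ℝ) (j : Fin m) (s t : ℝ) :
    orthantMass μ0 S j s * orthantMass μ0 S j t ≤ orthantMass μ0 S j ((s + t) / 2) ^ 2 := by
  rw [← ENNReal.ofReal_le_ofReal_iff (by positivity), ENNReal.ofReal_mul (orthantMass_nonneg _ _ _),
    ENNReal.ofReal_pow (orthantMass_nonneg _ _ _), ofReal_orthantMass hm hS,
    ofReal_orthantMass hm hS, ofReal_orthantMass hm hS]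
  have hmeas : ∀ t : ℝ, Measurable ({x : Fin m → ℝ | ∀ j, 0 ≤ x j}.indicator (fun x =>
      ENNReal.ofReal (Real.exp
        (-(1/2) * ((x - μ0 - t • S.col j) ⬝ᵥ S⁻¹ *ᵥ (x - μ0 - t • S.col j)))))) := fun t =>
    Measurable.indicator (Continuous.measurable (by fun_prop)).ennreal_ofReal measurableSet_orthant
  refine prekopa_leindler (hmeas s) (hmeas t) (hmeas _) fun x y => ?_
  by_cases hx : x ∈ {x : Fin m → ℝ | ∀ j, 0 ≤ x j}
  swap
  · simp [Set.indicator_of_notMem hx]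
  by_cases hy : y ∈ {x : Fin m → ℝ | ∀ j, 0 ≤ x j}
  swap
  · simp [Set.indicator_of_notMem hy]
  have hxy : (2⁻¹ : ℝ) • (x + y) ∈ {x : Fin m → ℝ | ∀ j, 0 ≤ x j} := fun i => by
    have := hx i
    have := hy i
    simp only [Pi.smul_apply, Pi.add_apply, smul_eq_mul]
    positivity
  rw [Set.indicator_of_mem hx, Set.indicator_of_mem hy, Set.indicator_of_mem hxy,
    ← ENNReal.ofReal_mul (Real.exp_pos _).le, ← ENNReal.ofReal_pow (Real.exp_pos _).le,
    ← Real.exp_add, ← Real.exp_nat_mul]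
  refine ENNReal.ofReal_le_ofReal (Real.exp_le_exp.2 ?_)
  have h := two_mul_inv_quadratic_midpoint_le hS (x - μ0 - s • S.col j) (y - μ0 - t • S.col j)
  have he : (2⁻¹ : ℝ) • (x - μ0 - s • S.col j + (y - μ0 - t • S.col j)) =
      (2⁻¹ : ℝ) • (x + y) - μ0 - ((s + t) / 2) • S.col j := by
    module
  rw [he] at h
  push_cast
  linarith

lemma orthantMass_pos (hm : 1 ≤ m) (hS : S.PosDef) (μ0 : Fin m → ℝ) (j : Fin m) (t : ℝ) :
    0 < orthantMass μ0 S j t := by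
  have : NeZero (volume.restrict {x : Fin m → ℝ | ∀ j, 0 ≤ x j}) := by
    refine ⟨fun h => ?_⟩
    rw [Measure.restrict_eq_zero] at h
    have h1 : {x : Fin m → ℝ | ∀ j, 0 ≤ x j} = Set.pi Set.univ fun _ => Set.Ici 0 := by
      ext x; simp [-Set.pi_univ_Ici]
    rw [h1, volume_pi_pi] at h
    simp at h
  exact integral_exp_pos (integrable_exp_neg_half_translate hm hS μ0 j t).integrableOn

lemma exp_mul_gaussian_density (hS : S.PosDef) (μ0 : Fin m → ℝ) (j : Fin m) (t : ℝ)
    (x : Fin m → ℝ) :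
    Real.exp (-(1/2) * ((x - μ0) ⬝ᵥ S⁻¹ *ᵥ (x - μ0))) * Real.exp (t * x j) =
      Real.exp (t * μ0 j + t ^ 2 * S j j / 2) *
      Real.exp (-(1/2) * ((x - μ0 - t • S.col j) ⬝ᵥ S⁻¹ *ᵥ (x - μ0 - t • S.col j))) := by
  rw [← Real.exp_add, ← Real.exp_add, inv_quadratic_sub_smul_col hS]
  congr 1
  simp only [Pi.sub_apply]
  ring

lemma truncNormal_eq (μ0 : Fin m → ℝ) (S : Matrix (Fin m) (Fin m) ℝ) (j : Fin m) :
    truncNormal m μ0 S =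
      (volume.restrict {x : Fin m → ℝ | ∀ j, 0 ≤ x j}).withDensity fun x => ENNReal.ofReal
        ((orthantMass μ0 S j 0)⁻¹ * Real.exp (-(1/2) * ((x - μ0) ⬝ᵥ S⁻¹ *ᵥ (x - μ0)))) := by
  simp [truncNormal, orthantMass]

lemma measurable_truncNormal_density (c : ℝ) (μ0 : Fin m → ℝ) (S : Matrix (Fin m) (Fin m) ℝ) :
    Measurable fun x : Fin m → ℝ => ENNReal.ofReal
      (c * Real.exp (-(1/2) * ((x - μ0) ⬝ᵥ S⁻¹ *ᵥ (x - μ0)))) :=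
  (Continuous.measurable (by fun_prop)).ennreal_ofReal

lemma truncNormal_density_mul_exp (hS : S.PosDef) (μ0 : Fin m → ℝ) (j : Fin m) (t : ℝ)
    (x : Fin m → ℝ) :
    (ENNReal.ofReal ((orthantMass μ0 S j 0)⁻¹ *
      Real.exp (-(1/2) * ((x - μ0) ⬝ᵥ S⁻¹ *ᵥ (x - μ0))))).toReal • Real.exp (t * x j) =
    ((orthantMass μ0 S j 0)⁻¹ * Real.exp (t * μ0 j + t ^ 2 * S j j / 2)) *
      Real.exp (-(1/2) * ((x - μ0 - t • S.col j) ⬝ᵥ S⁻¹ *ᵥ (x - μ0 - t • S.col j))) := by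
  rw [ENNReal.toReal_ofReal (mul_nonneg (inv_nonneg.2 (orthantMass_nonneg _ _ _))
    (Real.exp_pos _).le), smul_eq_mul, mul_assoc, exp_mul_gaussian_density hS, mul_assoc]

lemma integrable_exp_mul_truncNormal (hm : 1 ≤ m) (hS : S.PosDef) (μ0 : Fin m → ℝ) (j : Fin m)
    (t : ℝ) : Integrable (fun x : Fin m → ℝ => Real.exp (t * x j)) (truncNormal m μ0 S) := by
  rw [truncNormal_eq μ0 S j, integrable_withDensity_iff_integrable_smul'
    (measurable_truncNormal_density _ μ0 S)
    (Filter.Eventually.of_forall fun x => ENNReal.ofReal_lt_top)]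
  simp only [truncNormal_density_mul_exp hS]
  exact (integrable_exp_neg_half_translate hm hS μ0 j t).integrableOn.const_mul _

lemma mgf_truncNormal (hS : S.PosDef) (μ0 : Fin m → ℝ) (j : Fin m) (t : ℝ) :
    mgf (fun x : Fin m → ℝ => x j) (truncNormal m μ0 S) t =
      ((orthantMass μ0 S j 0)⁻¹ * Real.exp (t * μ0 j + t ^ 2 * S j j / 2)) *
        orthantMass μ0 S j t := by
  rw [mgf, truncNormal_eq μ0 S j, integral_withDensity_eq_integral_toReal_smul
    (measurable_truncNormal_density _ μ0 S)
    (Filter.Eventually.of_forall fun x => ENNReal.ofReal_lt_top)]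
  simp only [truncNormal_density_mul_exp hS]
  rw [integral_const_mul]
  rfl

lemma isProbabilityMeasure_truncNormal (hm : 1 ≤ m) (hS : S.PosDef) (μ0 : Fin m → ℝ) :
    IsProbabilityMeasure (truncNormal m μ0 S) := by
  let j : Fin m := ⟨0, hm⟩
  have h := mgf_truncNormal hS μ0 j 0
  rw [mgf_zero'] at h
  refine ⟨?_⟩
  have h1 : (truncNormal m μ0 S).real Set.univ = 1 := by
    rw [h]
    simp [inv_mul_cancel₀ (orthantMass_pos hm hS μ0 j 0).ne']
  rwa [Measure.real, ENNReal.toReal_eq_one_iff] at h1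

end Tilt

/-- The centered marginals of a truncated normal distribution are sub-Gaussian with
parameter at most `√(Σ_{jj})`. -/
theorem stmt_16 (m : ℕ) (hm : 1 ≤ m) (μ0 : Fin m → ℝ)
    (S : Matrix (Fin m) (Fin m) ℝ) (hS : S.PosDef) (j : Fin m) :
    Integrable (fun x : Fin m → ℝ => x j) (truncNormal m μ0 S) ∧
    ∀ t : ℝ,
      (∫⁻ x, ENNReal.ofReal (Real.exp (t * (x j - ∫ y, y j ∂(truncNormal m μ0 S))))
          ∂(truncNormal m μ0 S))
        ≤ ENNReal.ofReal (Real.exp (t ^ 2 * S j j / 2)) := by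
  have hprob := isProbabilityMeasure_truncNormal hm hS μ0
  have hint := integrable_exp_mul_truncNormal hm hS μ0 j
  have hZ := orthantMass_pos hm hS μ0 j 0
  have hmgf := mgf_le_of_mgf_half (σ := S j j) hint fun t => by
    have hred : ∀ u, mgf (fun x : Fin m → ℝ => x j) (truncNormal m μ0 S) u *
        Real.exp (-(u ^ 2 * S j j / 2)) =
        (orthantMass μ0 S j 0)⁻¹ * Real.exp (u * μ0 j) * orthantMass μ0 S j u := fun u => by
      have h : Real.exp (u * μ0 j) =
          Real.exp (u * μ0 j + u ^ 2 * S j j / 2) * Real.exp (-(u ^ 2 * S j j / 2)) := by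
        rw [← Real.exp_add]; ring_nf
      rw [mgf_truncNormal hS, h]; ring
    rw [hred, hred]
    have h := orthantMass_mul_le hm hS μ0 j 0 t
    rw [zero_add] at h
    have he : Real.exp (t * μ0 j) = Real.exp (t / 2 * μ0 j) ^ 2 := by
      rw [← Real.exp_nat_mul]; push_cast; ring_nf
    calc (orthantMass μ0 S j 0)⁻¹ * Real.exp (t * μ0 j) * orthantMass μ0 S j t
        = (orthantMass μ0 S j 0)⁻¹ ^ 2 * Real.exp (t * μ0 j) *
          (orthantMass μ0 S j 0 * orthantMass μ0 S j t) := by field_simp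
      _ ≤ (orthantMass μ0 S j 0)⁻¹ ^ 2 * Real.exp (t * μ0 j) * orthantMass μ0 S j (t / 2) ^ 2 := by
          gcongr
      _ = _ := by rw [he]; ring
  refine ⟨?_, fun t => ?_⟩
  · exact integrable_of_mem_interior_integrableExpSet (by
      rw [show integrableExpSet (fun x : Fin m → ℝ => x j) (truncNormal m μ0 S) = Set.univ from
        Set.eq_univ_of_forall hint]
      simp)
  · set M := ∫ y, y j ∂(truncNormal m μ0 S)
    have he : ∀ x : Fin m → ℝ, Real.exp (t * (x j - M)) =
        Real.exp (-(t * M)) * Real.exp (t * x j) := fun x => by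
      rw [← Real.exp_add]; ring_nf
    simp only [he]
    rw [← ofReal_integral_eq_lintegral_ofReal ((hint t).const_mul _)
      (Filter.Eventually.of_forall fun x => by positivity), integral_const_mul]
    refine ENNReal.ofReal_le_ofReal ?_
    calc Real.exp (-(t * M)) * ∫ x, Real.exp (t * x j) ∂(truncNormal m μ0 S)
        ≤ Real.exp (-(t * M)) * Real.exp (t * M + t ^ 2 * S j j / 2) := by
          gcongr; exact hmgf t
      _ = _ := by rw [← Real.exp_add]; ring_nf
end
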